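/- Let C be a skeletally small triangulated category and let B be a radical dense subcategory of C. Set H = image(δ^B_Q : G(B)_Q → G(C)_Q), and let D be the unique maximal element of I(H) (the set of dense subcategories D' with image(δ^{D'}_Q) = H, ordered by inclusion). Then B = D. In particular, B is the unique radical dense subcategory of C belonging to I(H). -/

import Mathlib

open CategoryTheory CategoryTheory.Limits CategoryTheory.Pretriangulated
open scoped TensorProduct

universe v u

set_option linter.unusedSectionVars false
set_option linter.unusedVariables false

namespace GrothendieckPaper

variable (C : Type u) [Category.{v} C] [Preadditive C] [Limits.HasZeroObject C]
  [HasShift C ℤ] [∀ n : ℤ, (shiftFunctor C n).Additive] [Pretriangulated C]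

/-- The set of Euler relations `[V] - [U] - [W]` coming from distinguished triangles
`U ⟶ V ⟶ W ⟶ U⟦1⟧`. -/
def eulerSet : Set (FreeAbelianGroup C) :=
  { x | ∃ T : Triangle C, (T ∈ distTriang C) ∧
      x = FreeAbelianGroup.of T.obj₂ - FreeAbelianGroup.of T.obj₁ - FreeAbelianGroup.of T.obj₃ }

def eulerSubgroup : AddSubgroup (FreeAbelianGroup C) := AddSubgroup.closure (eulerSet C)

/-- The Grothendieck group of a (skeletally small) triangulated category. -/
def G : Type u := FreeAbelianGroup C ⧸ eulerSubgroup C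

instance : AddCommGroup (G C) := QuotientAddGroup.Quotient.addCommGroup _

/-- The class `[U]` of an object `U` in the Grothendieck group. -/
def cls (U : C) : G C := QuotientAddGroup.mk (FreeAbelianGroup.of U)

/-- A (strictly full) triangulated subcategory of `C`, given by its set of objects:
closed under isomorphisms, under the shifts `[1]` and `[-1]`, and under extensions
(cones): if `X ⟶ Y ⟶ Z ⟶ X⟦1⟧` is distinguished and `X, Y` belong then so does `Z`. -/
structure IsTriangulatedSubcat (S : Set C) : Prop where
  mem_of_iso : ∀ {X Y : C}, (X ≅ Y) → Y ∈ S → X ∈ S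
  shift_mem : ∀ {X : C}, X ∈ S → ((shiftFunctor C (1 : ℤ)).obj X) ∈ S
  shift_neg_mem : ∀ {X : C}, X ∈ S → ((shiftFunctor C (-1 : ℤ)).obj X) ∈ S
  ext_mem : ∀ (T : Triangle C), (T ∈ distTriang C) → T.obj₁ ∈ S → T.obj₂ ∈ S → T.obj₃ ∈ S

/-- `npowAux U n` is the direct sum of `n + 1` copies of `U`. -/
noncomputable def npowAux (U : C) : ℕ → C
  | 0 => U
  | n + 1 => U ⊞ npowAux U n

/-- `npow U n` is the direct sum `U^n` of `n` copies of `U` (for `n ≥ 1`;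
`npow U 0` is defined to be `U` as a junk value). -/
noncomputable def npow (U : C) (n : ℕ) : C := npowAux C U (n - 1)

/-- A subcategory (set of objects) `S` is dense in `C` if every object of `C` is a
direct summand of an object of `S`. -/
def DenseSub (S : Set C) : Prop := ∀ U : C, ∃ V : C, (U ⊞ V) ∈ S

/-- A subcategory `S` is radical if `U^n ∈ S` for some `n ≥ 1` implies `U ∈ S`. -/
def RadicalSub (S : Set C) : Prop := ∀ (U : C) (n : ℕ), 1 ≤ n → npow C U n ∈ S → U ∈ S

/-- `√S = { U | U^n ∈ S for some n ≥ 1 }`. -/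
def sqrtSet (S : Set C) : Set C := { U : C | ∃ n : ℕ, 1 ≤ n ∧ npow C U n ∈ S }

lemma subset_sqrtSet (S : Set C) : S ⊆ sqrtSet C S := fun U hU => ⟨1, le_refl 1, hU⟩

/-- The Euler relations for the full subcategory on `S`, coming from distinguished
triangles of `C` all of whose vertices lie in `S`. -/
def eulerSetSub (S : Set C) : Set (FreeAbelianGroup S) :=
  { x | ∃ (T : Triangle C) (_ : T ∈ distTriang C) (h1 : T.obj₁ ∈ S) (h2 : T.obj₂ ∈ S)
      (h3 : T.obj₃ ∈ S),
      x = FreeAbelianGroup.of (⟨T.obj₂, h2⟩ : S) - FreeAbelianGroup.of ⟨T.obj₁, h1⟩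
        - FreeAbelianGroup.of ⟨T.obj₃, h3⟩ }

/-- The Grothendieck group of the triangulated subcategory on the set of objects `S`. -/
def GSub (S : Set C) : Type u := FreeAbelianGroup S ⧸ AddSubgroup.closure (eulerSetSub C S)

instance (S : Set C) : AddCommGroup (GSub C S) := QuotientAddGroup.Quotient.addCommGroup _

lemma delta_le (S : Set C) :
    AddSubgroup.closure (eulerSetSub C S) ≤
      (eulerSubgroup C).comap (FreeAbelianGroup.map (Subtype.val : S → C)) := by
  rw [AddSubgroup.closure_le]
  rintro x ⟨T, hT, h1, h2, h3, rfl⟩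
  simp only [SetLike.mem_coe, AddSubgroup.mem_comap, map_sub, FreeAbelianGroup.map_of_apply]
  exact AddSubgroup.subset_closure ⟨T, hT, rfl⟩

/-- The natural map `δ^S : G(S) → G(C)` induced by the inclusion of the subcategory. -/
def deltaHom (S : Set C) : GSub C S →+ G C :=
  QuotientAddGroup.map _ _ (FreeAbelianGroup.map (Subtype.val : S → C)) (delta_le C S)

lemma incl_le {S S' : Set C} (h : S ⊆ S') :
    AddSubgroup.closure (eulerSetSub C S) ≤
      (AddSubgroup.closure (eulerSetSub C S')).comap
        (FreeAbelianGroup.map (Set.inclusion h)) := by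
  rw [AddSubgroup.closure_le]
  rintro x ⟨T, hT, h1, h2, h3, rfl⟩
  simp only [SetLike.mem_coe, AddSubgroup.mem_comap, map_sub, FreeAbelianGroup.map_of_apply]
  exact AddSubgroup.subset_closure ⟨T, hT, h h1, h h2, h h3, rfl⟩

/-- The map `G(S) → G(S')` induced by an inclusion `S ⊆ S'` of subcategories. -/
def inclHom {S S' : Set C} (h : S ⊆ S') : GSub C S →+ GSub C S' :=
  QuotientAddGroup.map _ _ (FreeAbelianGroup.map (Set.inclusion h)) (incl_le C h)

/-- `δ^S ⊗ ℚ : G(S)_ℚ → G(C)_ℚ`. -/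
noncomputable def deltaQ (S : Set C) : ℚ ⊗[ℤ] GSub C S →ₗ[ℚ] ℚ ⊗[ℤ] G C :=
  LinearMap.baseChange ℚ (deltaHom C S).toIntLinearMap

/-- The rationalization of the map induced by an inclusion of subcategories. -/
noncomputable def inclQ {S S' : Set C} (h : S ⊆ S') :
    ℚ ⊗[ℤ] GSub C S →ₗ[ℚ] ℚ ⊗[ℤ] GSub C S' :=
  LinearMap.baseChange ℚ (inclHom C h).toIntLinearMap

/-- The collection `I(H)` of dense triangulated subcategories `S` of `C` with
`image(δ^S_ℚ) = H`. -/
def denseFamily (H : Submodule ℚ (ℚ ⊗[ℤ] G C)) : Set (Set C) :=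
  { S | IsTriangulatedSubcat C S ∧ DenseSub C S ∧ LinearMap.range (deltaQ C S) = H }

open ZeroObject

/-- In the Grothendieck group of a commutative monoid, the subgroup generated by a cofinal
submonoid `P` with the cancellation property pulls back to `P`. -/
lemma mem_of_mem_closure_image {M : Type*} [AddCommMonoid M] (P : AddSubmonoid M)
    (hcofinal : ∀ m, ∃ n, m + n ∈ P) (hcancel : ∀ a b, a ∈ P → b + a ∈ P → b ∈ P) {m : M}
    (hm : Algebra.GrothendieckAddGroup.of m ∈
      AddSubgroup.closure ((Algebra.GrothendieckAddGroup.of (M := M)) '' P)) : m ∈ P := by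
  have key : ∀ x ∈ AddSubgroup.closure ((Algebra.GrothendieckAddGroup.of (M := M)) '' P),
      ∃ p ∈ P, ∃ q ∈ P, x + Algebra.GrothendieckAddGroup.of q =
        Algebra.GrothendieckAddGroup.of p := by
    intro x hx
    induction hx using AddSubgroup.closure_induction with
    | mem x hx =>
      obtain ⟨p, hp, rfl⟩ := hx
      exact ⟨p, hp, 0, P.zero_mem, by rw [map_zero, add_zero]⟩
    | zero => exact ⟨0, P.zero_mem, 0, P.zero_mem, by rw [zero_add]⟩
    | add x y _ _ hx hy =>
      obtain ⟨p, hp, q, hq, h⟩ := hx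
      obtain ⟨p', hp', q', hq', h'⟩ := hy
      refine ⟨p + p', P.add_mem hp hp', q + q', P.add_mem hq hq', ?_⟩
      rw [map_add, map_add, ← h, ← h']
      abel
    | neg x _ hx =>
      obtain ⟨p, hp, q, hq, h⟩ := hx
      refine ⟨q, hq, p, hp, ?_⟩
      rw [← h]
      abel
  obtain ⟨p, hp, q, hq, h⟩ := key _ hm
  rw [← map_add] at h
  obtain ⟨⟨c, _⟩, hc⟩ := ((AddLocalization.addMonoidOf (⊤ : AddSubmonoid M)).eq_iff_exists).1 h
  obtain ⟨c', hc'⟩ := hcofinal c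
  refine hcancel (q + (c + c')) m (P.add_mem hq hc') ?_
  have : m + (q + (c + c')) = p + (c + c') := by
    calc m + (q + (c + c')) = (c + (m + q)) + c' := by abel
      _ = (c + p) + c' := by rw [show c + (m + q) = c + p from hc]
      _ = p + (c + c') := by abel
  rw [this]
  exact P.add_mem hp hc'

/-- If `1 ⊗ g` lies in the image of the rationalization of `f`, then a positive multiple of `g`
lies in the image of `f`. -/
lemma exists_nsmul_mem_range_of_tmul_mem_range {A A' : Type*} [AddCommGroup A] [AddCommGroup A']
    (f : A →+ A') (g : A')
    (hg : (1 : ℚ) ⊗ₜ[ℤ] g ∈ LinearMap.range (LinearMap.baseChange ℚ f.toIntLinearMap)) :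
    ∃ n : ℕ, 1 ≤ n ∧ n • g ∈ f.range := by
  let r := LinearMap.range f.toIntLinearMap
  have hzero : (1 : ℚ) ⊗ₜ[ℤ] r.mkQ g = 0 := by
    obtain ⟨x, hx⟩ := hg
    have h : LinearMap.baseChange ℚ r.mkQ (LinearMap.baseChange ℚ f.toIntLinearMap x) = 0 := by
      rw [← LinearMap.comp_apply, ← LinearMap.baseChange_comp,
        show r.mkQ ∘ₗ f.toIntLinearMap = 0 from LinearMap.range_mkQ_comp _,
        LinearMap.baseChange_zero, LinearMap.zero_apply]
    rw [hx] at h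
    exact h
  obtain ⟨s, hs⟩ := (IsLocalizedModule.eq_zero_iff (nonZeroDivisors ℤ)
    (TensorProduct.mk ℤ ℚ (A' ⧸ r) 1)).1 hzero
  have hs0 : (s : ℤ) ≠ 0 := nonZeroDivisors.coe_ne_zero s
  have hmem : (s : ℤ) • g ∈ f.range := by
    have h : r.mkQ ((s : ℤ) • g) = 0 := by rw [map_smul]; exact hs
    rw [Submodule.mkQ_apply, Submodule.Quotient.mk_eq_zero] at h
    exact h
  refine ⟨(s : ℤ).natAbs, Nat.one_le_iff_ne_zero.2 (Int.natAbs_ne_zero.2 hs0), ?_⟩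
  rw [← natCast_zsmul]
  rcases Int.natAbs_eq (s : ℤ) with h | h
  · rwa [← h]
  · rw [← neg_mem_iff, ← neg_smul, ← h]
    exact hmem

lemma exists_biprod_triangle (T₁ T₂ : Triangle C) (h₁ : T₁ ∈ distTriang C)
    (h₂ : T₂ ∈ distTriang C) :
    ∃ T : Triangle C, T ∈ distTriang C ∧ Nonempty (T.obj₁ ≅ T₁.obj₁ ⊞ T₂.obj₁) ∧
      Nonempty (T.obj₂ ≅ T₁.obj₂ ⊞ T₂.obj₂) ∧ Nonempty (T.obj₃ ≅ T₁.obj₃ ⊞ T₂.obj₃) := by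
  have e (f : WalkingPair → C) :
      Nonempty ((∏ᶜ f) ≅ f WalkingPair.left ⊞ f WalkingPair.right) :=
    ⟨{  hom := biprod.lift (Pi.π f WalkingPair.left) (Pi.π f WalkingPair.right)
        inv := Pi.lift fun j => match j with
          | WalkingPair.left => biprod.fst
          | WalkingPair.right => biprod.snd
        hom_inv_id := by
          refine Pi.hom_ext _ _ fun j => ?_
          cases j <;> simp
        inv_hom_id := by ext <;> simp }⟩
  let F : WalkingPair → Triangle C := fun j => WalkingPair.casesOn j T₁ T₂
  refine ⟨productTriangle F, productTriangle_distinguished F ?_, e fun j => (F j).obj₁,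
    e fun j => (F j).obj₂, e fun j => (F j).obj₃⟩
  rintro (_ | _)
  exacts [h₁, h₂]

/-- Isomorphism classes of objects of `C`. -/
def IsoClass : Type u := Quotient (isIsomorphicSetoid C)

variable {C}

namespace IsoClass

/-- The isomorphism class of an object. -/
def mk (X : C) : IsoClass C := Quotient.mk (isIsomorphicSetoid C) X

lemma mk_eq {X Y : C} (e : X ≅ Y) : mk X = mk Y := Quotient.sound ⟨e⟩

lemma nonempty_iso {X Y : C} (h : mk X = mk Y) : Nonempty (X ≅ Y) := Quotient.exact h

lemma exists_rep (x : IsoClass C) : ∃ X, mk X = x := Quotient.exists_rep x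

noncomputable instance : Add (IsoClass C) where
  add := Quotient.map₂ (fun X Y => X ⊞ Y) fun _ _ ⟨e⟩ _ _ ⟨e'⟩ => ⟨biprod.mapIso e e'⟩

noncomputable instance : Zero (IsoClass C) := ⟨mk 0⟩

lemma mk_biprod (X Y : C) : mk (X ⊞ Y) = mk X + mk Y := rfl

protected lemma zero_add (x : IsoClass C) : 0 + x = x := by
  obtain ⟨X, rfl⟩ := exists_rep x
  exact (mk_eq (isoZeroBiprod (isZero_zero C))).symm

protected lemma add_comm (x y : IsoClass C) : x + y = y + x := by
  obtain ⟨X, rfl⟩ := exists_rep x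
  obtain ⟨Y, rfl⟩ := exists_rep y
  exact mk_eq (biprod.braiding X Y)

protected lemma add_assoc (x y z : IsoClass C) : x + y + z = x + (y + z) := by
  obtain ⟨X, rfl⟩ := exists_rep x
  obtain ⟨Y, rfl⟩ := exists_rep y
  obtain ⟨Z, rfl⟩ := exists_rep z
  exact mk_eq (biprod.associator X Y Z)

noncomputable instance : AddCommMonoid (IsoClass C) where
  add_assoc := IsoClass.add_assoc
  zero_add := IsoClass.zero_add
  add_zero x := by rw [IsoClass.add_comm, IsoClass.zero_add]
  add_comm := IsoClass.add_comm
  nsmul := nsmulRec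

end IsoClass

lemma IsTriangulatedSubcat.mem_obj₂ {S : Set C} (hS : IsTriangulatedSubcat C S) (T : Triangle C)
    (hT : T ∈ distTriang C) (h₁ : T.obj₁ ∈ S) (h₃ : T.obj₃ ∈ S) : T.obj₂ ∈ S :=
  hS.ext_mem T.invRotate (inv_rot_of_distTriang _ hT) (hS.shift_neg_mem h₃) h₁

lemma IsTriangulatedSubcat.biprod_mem {S : Set C} (hS : IsTriangulatedSubcat C S) {X Y : C}
    (hX : X ∈ S) (hY : Y ∈ S) : (X ⊞ Y) ∈ S :=
  hS.mem_obj₂ _ (binaryBiproductTriangle_distinguished X Y) hX hY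

lemma IsTriangulatedSubcat.zero_mem {S : Set C} (hS : IsTriangulatedSubcat C S)
    (hd : DenseSub C S) : (0 : C) ∈ S := by
  obtain ⟨V, hV⟩ := hd 0
  exact hS.ext_mem _ (contractible_distinguished _) hV hV

/-- The submonoid of isomorphism classes of objects of a dense triangulated subcategory. -/
noncomputable def IsTriangulatedSubcat.isoClasses {S : Set C} (hS : IsTriangulatedSubcat C S)
    (hd : DenseSub C S) : AddSubmonoid (IsoClass C) where
  carrier := IsoClass.mk '' S
  zero_mem' := ⟨0, hS.zero_mem hd, rfl⟩
  add_mem' := by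
    rintro _ _ ⟨X, hX, rfl⟩ ⟨Y, hY, rfl⟩
    exact ⟨X ⊞ Y, hS.biprod_mem hX hY, rfl⟩

lemma IsTriangulatedSubcat.mk_mem_isoClasses {S : Set C} (hS : IsTriangulatedSubcat C S)
    (hd : DenseSub C S) {X : C} : IsoClass.mk X ∈ hS.isoClasses hd ↔ X ∈ S := by
  refine ⟨?_, fun h => ⟨X, h, rfl⟩⟩
  rintro ⟨Y, hY, h⟩
  obtain ⟨e⟩ := IsoClass.nonempty_iso h
  exact hS.mem_of_iso e.symm hY

/-- An extension of complemented objects: if `X ⊞ X'` and `Z ⊞ Z'` lie in `S`, so does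
`(Y ⊞ X') ⊞ Z'` for every triangle `X ⟶ Y ⟶ Z ⟶ X⟦1⟧`. -/
lemma IsTriangulatedSubcat.biprod_obj₂_mem {S : Set C} (hS : IsTriangulatedSubcat C S)
    (T : Triangle C) (hT : T ∈ distTriang C) {X' Z' : C} (hX : (T.obj₁ ⊞ X') ∈ S)
    (hZ : (T.obj₃ ⊞ Z') ∈ S) : ((T.obj₂ ⊞ X') ⊞ Z') ∈ S := by
  obtain ⟨T', hT', ⟨e₁⟩, ⟨e₂⟩, ⟨e₃⟩⟩ :=
    exists_biprod_triangle C T _ hT (contractible_distinguished X')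
  obtain ⟨T'', hT'', ⟨f₁⟩, ⟨f₂⟩, ⟨f₃⟩⟩ :=
    exists_biprod_triangle C T' _ hT' (contractible_distinguished₁ Z')
  refine hS.mem_of_iso (biprod.mapIso e₂.symm (Iso.refl Z') ≪≫ f₂.symm)
    (hS.mem_obj₂ T'' hT'' (hS.mem_of_iso ?_ hX) (hS.mem_of_iso ?_ hZ))
  · exact f₁ ≪≫ (isoBiprodZero (isZero_zero C)).symm ≪≫ e₁
  · exact f₃ ≪≫ biprod.mapIso
      (e₃ ≪≫ (isoBiprodZero (X := T.obj₃) (isZero_zero C)).symm) (Iso.refl Z')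

/-- Thomason: an object whose class lies in the image of `G(S)` belongs to the dense
triangulated subcategory `S`. -/
lemma IsTriangulatedSubcat.mem_of_cls_mem_range {S : Set C} (hS : IsTriangulatedSubcat C S)
    (hd : DenseSub C S) {U : C} (hU : cls C U ∈ (deltaHom C S).range) : U ∈ S := by
  let P := hS.isoClasses hd
  let N := AddSubgroup.closure ((Algebra.GrothendieckAddGroup.of (M := IsoClass C)) '' P)
  let φ : IsoClass C →+ Algebra.GrothendieckAddGroup (IsoClass C) ⧸ N :=
    (QuotientAddGroup.mk' N).comp Algebra.GrothendieckAddGroup.of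
  have hφ {X : C} (hX : X ∈ S) : φ (IsoClass.mk X) = 0 :=
    (QuotientAddGroup.eq_zero_iff _).2 (AddSubgroup.subset_closure ⟨_, ⟨X, hX, rfl⟩, rfl⟩)
  let ψ : FreeAbelianGroup C →+ Algebra.GrothendieckAddGroup (IsoClass C) ⧸ N :=
    FreeAbelianGroup.lift fun X => φ (IsoClass.mk X)
  have hψ : eulerSubgroup C ≤ ψ.ker := by
    rw [eulerSubgroup, AddSubgroup.closure_le]
    rintro _ ⟨T, hT, rfl⟩
    obtain ⟨X', hX⟩ := hd T.obj₁
    obtain ⟨Z', hZ⟩ := hd T.obj₃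
    have hY := hφ (hS.biprod_obj₂_mem T hT hX hZ)
    replace hX := hφ hX
    replace hZ := hφ hZ
    simp only [IsoClass.mk_biprod, map_add] at hX hY hZ
    simp only [SetLike.mem_coe, AddMonoidHom.mem_ker, map_sub, ψ, FreeAbelianGroup.lift_apply_of]
    calc _ = (φ (IsoClass.mk T.obj₂) + φ (IsoClass.mk X') + φ (IsoClass.mk Z'))
          - (φ (IsoClass.mk T.obj₁) + φ (IsoClass.mk X'))
          - (φ (IsoClass.mk T.obj₃) + φ (IsoClass.mk Z')) := by abel
      _ = 0 := by rw [hX, hY, hZ, sub_zero, sub_zero]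
  let χ : G C →+ Algebra.GrothendieckAddGroup (IsoClass C) ⧸ N :=
    QuotientAddGroup.lift (eulerSubgroup C) ψ hψ
  have hχ (X : C) : χ (cls C X) = φ (IsoClass.mk X) := FreeAbelianGroup.lift_apply_of _ _
  have hzero : χ.comp (deltaHom C S) = 0 := by
    refine QuotientAddGroup.addMonoidHom_ext _ (FreeAbelianGroup.lift_ext _ _ ?_)
    rintro ⟨X, hX⟩
    exact (hχ X).trans (hφ hX)
  obtain ⟨x, hx⟩ := hU
  have h : φ (IsoClass.mk U) = 0 := by
    rw [← hχ, ← hx]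
    exact DFunLike.congr_fun hzero x
  refine (hS.mk_mem_isoClasses hd).1 (mem_of_mem_closure_image P ?_ ?_
    ((QuotientAddGroup.eq_zero_iff _).1 h))
  · intro m
    obtain ⟨X, rfl⟩ := IsoClass.exists_rep m
    obtain ⟨V, hV⟩ := hd X
    exact ⟨IsoClass.mk V, _, hV, rfl⟩
  · intro a b ha hab
    obtain ⟨X, rfl⟩ := IsoClass.exists_rep a
    obtain ⟨Y, rfl⟩ := IsoClass.exists_rep b
    rw [← IsoClass.mk_biprod] at hab
    rw [hS.mk_mem_isoClasses hd] at ha hab ⊢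
    exact hS.ext_mem _ (binaryBiproductTriangle_distinguished X Y) ha
      (hS.mem_of_iso (biprod.braiding X Y) hab)

lemma cls_biprod (X Y : C) : cls C (X ⊞ Y) = cls C X + cls C Y := by
  have h : (QuotientAddGroup.mk (FreeAbelianGroup.of (X ⊞ Y) - FreeAbelianGroup.of X -
      FreeAbelianGroup.of Y) : FreeAbelianGroup C ⧸ eulerSubgroup C) = 0 :=
    (QuotientAddGroup.eq_zero_iff _).2 (AddSubgroup.subset_closure
      ⟨_, binaryBiproductTriangle_distinguished X Y, rfl⟩)
  have h' : cls C (X ⊞ Y) - cls C X - cls C Y = 0 := h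
  rwa [sub_sub, sub_eq_zero] at h'

lemma cls_npow (U : C) {n : ℕ} (hn : 1 ≤ n) : cls C (npow C U n) = n • cls C U := by
  obtain ⟨n, rfl⟩ := Nat.exists_eq_add_of_le' hn
  rw [npow, Nat.add_sub_cancel]
  clear hn
  induction n with
  | zero => rw [zero_add, one_smul]; rfl
  | succ n ih => rw [npowAux, cls_biprod, ih, succ_nsmul' _ (n + 1)]

lemma tmul_cls_mem_range {S : Set C} {U : C} (hU : U ∈ S) :
    (1 : ℚ) ⊗ₜ[ℤ] cls C U ∈ LinearMap.range (deltaQ C S) :=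
  ⟨(1 : ℚ) ⊗ₜ[ℤ] (QuotientAddGroup.mk (FreeAbelianGroup.of ⟨U, hU⟩) : GSub C S), rfl⟩

/-- A radical dense triangulated subcategory is determined by the image of its rationalized
Grothendieck group. -/
lemma IsTriangulatedSubcat.mem_iff_tmul_cls_mem_range {S : Set C}
    (hS : IsTriangulatedSubcat C S) (hd : DenseSub C S) (hr : RadicalSub C S) (U : C) :
    U ∈ S ↔ (1 : ℚ) ⊗ₜ[ℤ] cls C U ∈ LinearMap.range (deltaQ C S) := by
  refine ⟨tmul_cls_mem_range, fun h => ?_⟩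
  obtain ⟨n, hn, hU⟩ := exists_nsmul_mem_range_of_tmul_mem_range _ _ h
  rw [← cls_npow U hn] at hU
  exact hr U n hn (hS.mem_of_cls_mem_range hd hU)

variable (C)

/-- a radical dense subcategory `B` coincides with the unique maximal element
of `I(H)` for `H = image δ^B_ℚ`; in particular `B` is the unique radical dense
subcategory of `C` belonging to `I(H)`. -/
theorem radical_dense_eq_maximal (B : Set C) (hB : IsTriangulatedSubcat C B)
    (hBdense : DenseSub C B) (hBrad : RadicalSub C B) (D : Set C)
    (hD : D ∈ denseFamily C (LinearMap.range (deltaQ C B)))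
    (hDmax : ∀ S' ∈ denseFamily C (LinearMap.range (deltaQ C B)), D ⊆ S' → S' = D) :
    B = D ∧
    ∀ B' : Set C, IsTriangulatedSubcat C B' → DenseSub C B' → RadicalSub C B' →
      B' ∈ denseFamily C (LinearMap.range (deltaQ C B)) → B' = B := by
  constructor
  · refine hDmax B ⟨hB, hBdense, rfl⟩ fun U hU => ?_
    rw [hB.mem_iff_tmul_cls_mem_range hBdense hBrad, ← hD.2.2]
    exact tmul_cls_mem_range hU
  · intro B' hB' hd' hr' hmem
    ext U
    rw [hB'.mem_iff_tmul_cls_mem_range hd' hr', hB.mem_iff_tmul_cls_mem_range hBdense hBrad,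
      hmem.2.2]


end GrothendieckPaper
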